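/- Let A be a commutative ring, let I = ⟨f_1,...,f_r⟩ be a finitely generated ideal, and let P be a prime ideal of the Rees algebra A[It]. Suppose for some index i the degree-one element f_i t of A[It] does not lie in P. Then in the localization A[It]_P, the ideal generated by the image of I (embedded in degree zero) equals the principal ideal generated by the image of f_i (in degree zero): I·A[It]_P = f_i·A[It]_P. -/

import Mathlib

open Polynomial

/-- In the Rees algebra, `a · (b t) = b · (a t)` for `a, b ∈ I`. -/
theorem reesAlgebra.algebraMap_mul_monomial_one_comm {A : Type*} [CommRing A] {I : Ideal A}
    (a b : A) (ha : monomial 1 a ∈ reesAlgebra I) (hb : monomial 1 b ∈ reesAlgebra I) :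
    algebraMap A (reesAlgebra I) a * ⟨monomial 1 b, hb⟩ =
      algebraMap A (reesAlgebra I) b * ⟨monomial 1 a, ha⟩ := by
  apply Subtype.ext
  change algebraMap A A[X] a * monomial 1 b = algebraMap A A[X] b * monomial 1 a
  simp only [Polynomial.algebraMap_apply, Algebra.algebraMap_self, RingHom.id_apply,
    C_mul_monomial, mul_comm]

/-- Let `I = ⟨f_1,...,f_r⟩` be a finitely generated ideal of `A` and `P` a prime of the Rees
algebra `A[It]` with `f_i t ∉ P` for some `i`.  Then in the localization `A[It]_P` the ideal
generated by the (degree-zero) image of `I` is the principal ideal generated by the image of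
`f_i`: `I·A[It]_P = f_i·A[It]_P`. -/
theorem rees_localization_ideal_eq_principal {A : Type*} [CommRing A] {r : ℕ}
    (f : Fin r → A) (I : Ideal A) (hI : I = Ideal.span (Set.range f))
    (P : Ideal ↥(reesAlgebra I)) [P.IsPrime]
    (i : Fin r) (hmem : Polynomial.monomial 1 (f i) ∈ reesAlgebra I)
    (hi : (⟨Polynomial.monomial 1 (f i), hmem⟩ : ↥(reesAlgebra I)) ∉ P) :
    Ideal.span
        (⇑((algebraMap ↥(reesAlgebra I) (Localization.AtPrime P)).comp
            (algebraMap A ↥(reesAlgebra I))) '' (I : Set A))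
      = Ideal.span
          {((algebraMap ↥(reesAlgebra I) (Localization.AtPrime P)).comp
              (algebraMap A ↥(reesAlgebra I))) (f i)} := by
  apply le_antisymm
  · rw [Ideal.span_le]
    rintro _ ⟨a, ha, rfl⟩
    have ha' : monomial 1 a ∈ reesAlgebra I :=
      reesAlgebra.monomial_mem.mpr (by simpa using ha)
    have hu := IsLocalization.map_units (Localization.AtPrime P)
      (⟨⟨monomial 1 (f i), hmem⟩, hi⟩ : P.primeCompl)
    rw [SetLike.mem_coe, Ideal.mem_span_singleton, ← hu.dvd_mul_right, RingHom.comp_apply,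
      RingHom.comp_apply, ← map_mul,
      reesAlgebra.algebraMap_mul_monomial_one_comm a (f i) ha' hmem, map_mul]
    exact dvd_mul_right _ _
  · rw [Ideal.span_singleton_le_iff_mem]
    refine Ideal.subset_span ⟨f i, ?_, rfl⟩
    rw [hI]
    exact Ideal.subset_span (Set.mem_range_self i)
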